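/- For points p_1,…,p_5 in general position in P^3, the fat points ideal I(2,2,2,1,1) = m_{p_1}^2 ∩ m_{p_2}^2 ∩ m_{p_3}^2 ∩ m_{p_4} ∩ m_{p_5} satisfies γ(I(2,2,2,1,1)) ≥ 8/3; in fact the fat points ideal I(6m,6m,6m,3m,3m) contains no nonzero form of degree 8m−1 for any integer m ≥ 1. -/

import Mathlib

open MvPolynomial Filter

/-- The homogeneous ideal of all forms vanishing at the (projective) point with
coordinate vector `p`. -/
noncomputable def pointIdeal {k : Type*} [Field k] {σ : Type*} (p : σ → k) :
    Ideal (MvPolynomial σ k) :=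
  Ideal.span { f | (∃ d, f.IsHomogeneous d) ∧ eval p f = 0 }

/-- The fat points ideal `⋂ⱼ m_{pⱼ}^{mⱼ}` (natural multiplicities). -/
noncomputable def fatIdeal {k : Type*} [Field k] {N n : ℕ} (p : Fin n → (Fin (N + 1) → k))
    (m : Fin n → ℕ) : Ideal (MvPolynomial (Fin (N + 1)) k) :=
  ⨅ j, pointIdeal (p j) ^ (m j)

/-- The fat points ideal with integer multiplicities, with the convention
`m_p^m = (1)` for `m ≤ 0`. -/
noncomputable def fatIdealZ {k : Type*} [Field k] {N n : ℕ} (p : Fin n → (Fin (N + 1) → k))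
    (m : Fin n → ℤ) : Ideal (MvPolynomial (Fin (N + 1)) k) :=
  ⨅ j, pointIdeal (p j) ^ (m j).toNat

/-- The irrelevant maximal ideal `M = (x_0, …, x_N)`. -/
noncomputable def maxIdeal (k : Type*) [Field k] (N : ℕ) : Ideal (MvPolynomial (Fin (N + 1)) k) :=
  Ideal.span (Set.range X)

/-- `α(I)`: the least `t ≥ 0` such that `I` contains a nonzero form of degree `t`. -/
noncomputable def alpha {k : Type*} [Field k] {σ : Type*}
    (I : Ideal (MvPolynomial σ k)) : ℕ :=
  sInf { t | ∃ f ∈ I, f ≠ 0 ∧ f.IsHomogeneous t }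

/-- The sequence `t ↦ α(I^{(t)})/t` attached to the fat points ideal with points `p`
and multiplicities `m`; its limit as `t → ∞` is the Waldschmidt constant `γ`. -/
noncomputable def alphaSeq {k : Type*} [Field k] {N n : ℕ}
    (p : Fin n → (Fin (N + 1) → k)) (m : Fin n → ℕ) (t : ℕ) : ℝ :=
  (alpha (fatIdeal p fun j => t * m j) : ℝ) / t

/-- `P` holds for `n`-tuples of points of `P^N` in general position: there is a
nonempty Zariski-open subset (the complement of the zero locus of a set `S` of
polynomials in the coordinates of the tuple) of tuples of nonzero coordinate
vectors on which `P` holds. -/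
def Generic (k : Type*) [Field k] (N n : ℕ)
    (P : (Fin n → (Fin (N + 1) → k)) → Prop) : Prop :=
  ∃ S : Set (MvPolynomial (Fin n × Fin (N + 1)) k),
    (∃ p : Fin n → (Fin (N + 1) → k), (∀ j, p j ≠ 0) ∧
      ∃ f ∈ S, eval (fun q => p q.1 q.2) f ≠ 0) ∧
    ∀ p : Fin n → (Fin (N + 1) → k), (∀ j, p j ≠ 0) →
      (∃ f ∈ S, eval (fun q => p q.1 q.2) f ≠ 0) → P p


lemma aeval_eq_eval_aux {k : Type*} [Field k] {σ : Type*} (u : σ → k) (g : MvPolynomial σ k) :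
    aeval u g = eval u g :=
  DFunLike.congr_fun (coe_aeval_eq_eval u) g

/-- A homogeneous polynomial scales under evaluation. -/
lemma eval_scale {k : Type*} [Field k] {σ : Type*} {f : MvPolynomial σ k} {d : ℕ}
    (hf : f.IsHomogeneous d) (s : k) (v : σ → k) :
    eval (fun i => s * v i) f = s ^ d * eval v f := by
  rw [eval_eq, eval_eq, Finset.mul_sum]
  refine Finset.sum_congr rfl fun e he => ?_
  have h1 := hf (mem_support_iff.mp he)
  have h2 : ∑ i ∈ e.support, e i = d := by
    rw [← h1, Finsupp.weight_apply, Finsupp.sum]; simp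
  simp only [mul_pow, Finset.prod_mul_distrib, Finset.prod_pow_eq_pow_sum, h2]
  ring

/-- Nontrivial relation with nonzero coefficients among five points in linearly general position. -/
lemma exists_relation {k : Type*} [Field k] (p : Fin 5 → Fin 4 → k)
    (h : ∀ j : Fin 5, (Matrix.of fun i : Fin 4 => p (j.succAbove i)).det ≠ 0) :
    ∃ a : Fin 5 → k, (∀ j, a j ≠ 0) ∧ ∀ i, ∑ j, a j * p j i = 0 := by
  have hli : ¬ LinearIndependent k p := by
    intro hl
    have := hl.fintype_card_le_finrank
    simp at this
  obtain ⟨a, ha, j0, hj0⟩ := Fintype.not_linearIndependent_iff.mp hli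
  have ha' : ∀ i, ∑ j, a j * p j i = 0 := by
    intro i
    have := congrFun ha i
    simpa [Finset.sum_apply] using this
  refine ⟨a, ?_, ha'⟩
  intro j hj
  have h0 : (fun i : Fin 4 => a (j.succAbove i)) = 0 := by
    apply Matrix.eq_zero_of_vecMul_eq_zero (h j)
    ext i
    have := ha' i
    rw [Fin.sum_univ_succAbove _ j, hj, zero_mul, zero_add] at this
    simpa [Matrix.vecMul, dotProduct] using this
  apply hj0
  rcases Fin.eq_self_or_eq_succAbove j j0 with h1 | ⟨i, h1⟩
  · rw [h1, hj]
  · rw [h1]; exact congrFun h0 i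

/-- A generic point on which `f` does not vanish. -/
lemma exists_params {k : Type*} [Field k] [CharZero k] (p : Fin 5 → Fin 4 → k)
    (h : ∀ j : Fin 5, (Matrix.of fun i : Fin 4 => p (j.succAbove i)).det ≠ 0)
    (a : Fin 5 → k) (ha : ∀ j, a j ≠ 0) (f : MvPolynomial (Fin 4) k) (hf : f ≠ 0) :
    ∃ u : Fin 5 → k, (∀ j, u j ≠ 0) ∧ Function.Injective u ∧
      eval (fun i => ∑ j, a j * u j * p j i) f ≠ 0 := by
  classical
  set G : MvPolynomial (Fin 5) k :=
    aeval (fun i => ∑ j, C (a j * p j i) * X j) f with hG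
  have hGe : ∀ u : Fin 5 → k, eval u G = eval (fun i => ∑ j, a j * u j * p j i) f := by
    intro u
    have e1 : eval u G = aeval u G := (aeval_eq_eval_aux u G).symm
    rw [e1, hG, ← AlgHom.comp_apply, comp_aeval, aeval_eq_eval_aux]
    congr 2
    funext i
    simp [map_sum, mul_right_comm]
  have hG0 : G ≠ 0 := by
    intro h0
    obtain ⟨q, hq⟩ : ∃ q, eval q f ≠ 0 := by
      by_contra! hc
      exact hf (MvPolynomial.funext fun q => by simpa using hc q)
    apply hq
    set M := (Matrix.of fun i : Fin 4 => p ((0 : Fin 5).succAbove i)) with hM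
    have hu : IsUnit M.det := isUnit_iff_ne_zero.mpr (h 0)
    set w := Matrix.vecMul q M⁻¹ with hw
    have hwq : Matrix.vecMul w M = q := by
      rw [hw, Matrix.vecMul_vecMul, Matrix.nonsing_inv_mul _ hu, Matrix.vecMul_one]
    have := hGe (Fin.cons 0 fun i => (a i.succ)⁻¹ * w i)
    rw [h0, map_zero] at this
    rw [this]
    congr 2
    rw [← hwq]
    funext i
    rw [Fin.sum_univ_succ]
    simp [Matrix.vecMul, dotProduct, hM, ha]
  set D : MvPolynomial (Fin 5) k :=
    (∏ j, X j) * ∏ ij ∈ (Finset.univ : Finset (Fin 5)).offDiag, (X ij.1 - X ij.2) with hD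
  have hD0 : D ≠ 0 := by
    refine mul_ne_zero (Finset.prod_ne_zero_iff.mpr fun j _ => X_ne_zero j)
      (Finset.prod_ne_zero_iff.mpr fun ij hij => ?_)
    rw [Finset.mem_offDiag] at hij
    rw [sub_ne_zero]
    exact fun hx => hij.2.2 (X_injective hx)
  obtain ⟨u, hu⟩ : ∃ u, eval u (G * D) ≠ 0 := by
    by_contra! hc
    exact mul_ne_zero hG0 hD0 (MvPolynomial.funext fun q => by simpa using hc q)
  rw [hD] at hu
  simp only [map_mul, map_prod, map_sub, eval_X, mul_ne_zero_iff, Finset.prod_ne_zero_iff,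
    Finset.mem_offDiag, Finset.mem_univ, true_and, true_imp_iff] at hu
  refine ⟨u, hu.2.1, ?_, (hGe u) ▸ hu.1⟩
  intro i j hij
  by_contra hne
  exact hu.2.2 (i, j) hne (sub_eq_zero.mpr hij)

/-- Main inequality: the twisted cubic argument. -/
lemma main_ineq {k : Type*} [Field k] [CharZero k] (p : Fin 5 → Fin 4 → k)
    (h : ∀ j : Fin 5, (Matrix.of fun i : Fin 4 => p (j.succAbove i)).det ≠ 0)
    (m : Fin 5 → ℕ) (d : ℕ) (f : MvPolynomial (Fin 4) k)
    (hfI : f ∈ fatIdeal (N := 3) p m) (hf : f ≠ 0) (hd : f.IsHomogeneous d) :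
    ∑ j, m j ≤ d * 3 := by
  classical
  obtain ⟨a, ha, hrel⟩ := exists_relation p h
  obtain ⟨u, hu0, huinj, huf⟩ := exists_params p h a ha f hf
  set b : Fin 5 → k := fun j => -(u j)⁻¹ with hb
  have hbinj : Function.Injective b := by
    intro i j hij
    apply huinj
    simpa [hb] using hij
  set Q : Fin 5 → Polynomial k :=
    fun j => ∏ l ∈ Finset.univ.erase j, (Polynomial.X - Polynomial.C (b l)) with hQ
  set x : Fin 4 → Polynomial k := fun i => ∑ j, Polynomial.C (a j * p j i) * Q j with hx
  have hQdeg : ∀ j, (Q j).natDegree = 4 := by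
    intro j
    rw [hQ]
    simp only
    rw [Polynomial.natDegree_prod_of_monic _ _ fun l _ => Polynomial.monic_X_sub_C _]
    simp
  have hQmon : ∀ j, (Q j).Monic := fun j =>
    Polynomial.monic_prod_of_monic _ _ fun l _ => Polynomial.monic_X_sub_C _
  have hxdeg : ∀ i, (x i).natDegree ≤ 3 := by
    intro i
    rw [Polynomial.natDegree_le_iff_coeff_eq_zero]
    intro n hn
    simp only [hx, Polynomial.finsetSum_coeff, Polynomial.coeff_C_mul]
    rcases Nat.eq_or_lt_of_le (Nat.succ_le_of_lt hn) with h4 | h4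
    · rw [← hrel i]
      refine Finset.sum_congr rfl fun j _ => ?_
      have h5 := hQmon j
      rw [Polynomial.Monic, Polynomial.leadingCoeff, hQdeg j] at h5
      rw [← h4]
      simp [h5]
    · refine Finset.sum_eq_zero fun j _ => ?_
      rw [Polynomial.coeff_eq_zero_of_natDegree_lt (by rw [hQdeg j]; exact h4), mul_zero]
  have hQe : ∀ j l, l ≠ j → (Q j).eval (b l) = 0 := by
    intro j l hl
    simp only [hQ, Polynomial.eval_prod]
    exact Finset.prod_eq_zero (Finset.mem_erase.mpr ⟨hl, Finset.mem_univ _⟩) (by simp)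
  have hev : ∀ (c : k) (g : MvPolynomial (Fin 4) k),
      (aeval x g).eval c = eval (fun i => (x i).eval c) g := by
    intro c g
    have e1 : (aeval x g).eval c = Polynomial.aeval c (aeval x g) := by
      rw [Polynomial.coe_aeval_eq_eval]
    rw [e1, ← AlgHom.comp_apply, comp_aeval, aeval_eq_eval_aux]
    simp only [Polynomial.coe_aeval_eq_eval]
  have hdvd : ∀ j, (Polynomial.X - Polynomial.C (b j)) ^ m j ∣ aeval x f := by
    intro j
    have hle : (pointIdeal (p j)).map (aeval x : MvPolynomial (Fin 4) k →ₐ[k] Polynomial k) ≤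
        Ideal.span {Polynomial.X - Polynomial.C (b j)} := by
      rw [Ideal.map_le_iff_le_comap]
      refine Ideal.span_le.mpr ?_
      rintro g ⟨⟨e, he⟩, hg⟩
      simp only [SetLike.mem_coe, Ideal.mem_comap]
      rw [Ideal.mem_span_singleton, Polynomial.dvd_iff_isRoot, Polynomial.IsRoot.def]
      erw [hev]
      have : (fun i => (x i).eval (b j)) = fun i => (a j * (Q j).eval (b j)) * p j i := by
        funext i
        simp only [hx, Polynomial.eval_finsetSum, Polynomial.eval_mul, Polynomial.eval_C]
        rw [Finset.sum_eq_single j]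
        · ring
        · intro l _ hl
          rw [hQe l j hl.symm, mul_zero]
        · simp
      rw [this, eval_scale he, hg, mul_zero]
    have hm : f ∈ pointIdeal (p j) ^ m j := (Ideal.mem_iInf.mp hfI) j
    have h2 := Ideal.mem_map_of_mem (aeval x : MvPolynomial (Fin 4) k →ₐ[k] Polynomial k) hm
    rw [Ideal.map_pow] at h2
    have h3 := Ideal.pow_right_mono hle (m j) h2
    rwa [Ideal.span_singleton_pow, Ideal.mem_span_singleton] at h3
  have hprod : ∏ j, (Polynomial.X - Polynomial.C (b j)) ^ m j ∣ aeval x f := by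
    apply Finset.prod_dvd_of_coprime
    · intro i _ j _ hij
      exact (Polynomial.pairwise_coprime_X_sub_C hbinj hij).pow
    · intro j _
      exact hdvd j
  have hne : aeval x f ≠ 0 := by
    intro h0
    have h1 := hev 0 f
    rw [h0, Polynomial.eval_zero] at h1
    have : (fun i => (x i).eval 0) =
        fun i => (∏ l, (u l)⁻¹) * (∑ j, a j * u j * p j i) := by
      funext i
      simp only [hx, Polynomial.eval_finsetSum, Polynomial.eval_mul, Polynomial.eval_C,
        Finset.mul_sum]
      refine Finset.sum_congr rfl fun j _ => ?_
      rw [← Finset.mul_prod_erase Finset.univ (fun l => (u l)⁻¹) (Finset.mem_univ j)]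
      simp only [hQ, hb, Polynomial.eval_prod, Polynomial.eval_sub, Polynomial.eval_X,
        Polynomial.eval_C, zero_sub, neg_neg]
      have := hu0 j
      field_simp
    rw [this, eval_scale hd] at h1
    refine mul_ne_zero (pow_ne_zero _ (Finset.prod_ne_zero_iff.mpr fun l _ =>
      inv_ne_zero (hu0 l))) huf h1.symm
  have hdeg := Polynomial.natDegree_le_of_dvd hprod hne
  rw [Polynomial.natDegree_prod_of_monic _ _ fun l _ => (Polynomial.monic_X_sub_C _).pow _] at hdeg
  simp only [Polynomial.natDegree_pow, Polynomial.natDegree_X_sub_C, mul_one] at hdeg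
  exact hdeg.trans (aeval_natDegree_le f hd.totalDegree_le x hxdeg)

/-- Fat point ideals contain nonzero forms. -/
lemma exists_form {k : Type*} [Field k] (p : Fin 5 → Fin 4 → k) (m : Fin 5 → ℕ) :
    ∃ t, ∃ f ∈ fatIdeal (N := 3) p m, f ≠ 0 ∧ f.IsHomogeneous t := by
  have hL : ∀ j, ∃ L ∈ pointIdeal (p j), L ≠ 0 ∧ L.IsHomogeneous 1 := by
    intro j
    by_cases h0 : p j 0 = 0
    · exact ⟨X 0, Ideal.subset_span ⟨⟨1, isHomogeneous_X _ _⟩, by simpa using h0⟩,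
        X_ne_zero _, isHomogeneous_X _ _⟩
    · have hh : (C (p j 0) * X 1 - C (p j 1) * X 0 : MvPolynomial (Fin 4) k).IsHomogeneous 1 :=
        ((isHomogeneous_X _ _).C_mul _).sub ((isHomogeneous_X _ _).C_mul _)
      refine ⟨_, Ideal.subset_span ⟨⟨1, hh⟩, ?_⟩, ?_, hh⟩
      · simp [mul_comm]
      · intro hz
        have := congrArg (eval (Pi.single 1 1 : Fin 4 → k)) hz
        simp [h0] at this
  choose L hLm hL0 hLh using hL
  refine ⟨∑ j, 1 * m j, ∏ j, L j ^ m j, ?_, ?_, ?_⟩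
  · refine Ideal.mem_iInf.mpr fun j => ?_
    exact Ideal.mem_of_dvd _ (Finset.dvd_prod_of_mem (fun j => L j ^ m j) (Finset.mem_univ j))
      (Ideal.pow_mem_pow (hLm j) _)
  · exact Finset.prod_ne_zero_iff.mpr fun j _ => pow_ne_zero _ (hL0 j)
  · exact IsHomogeneous.prod _ _ _ fun j _ => (hLh j).pow _

theorem statement13 (k : Type*) [Field k] [CharZero k] :
    Generic k 3 5 (fun p =>
      (∀ γ : ℝ, Tendsto (alphaSeq p ![2, 2, 2, 1, 1]) atTop (nhds γ) → 8 / 3 ≤ γ) ∧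
      ∀ m : ℕ, 1 ≤ m →
        ¬ ∃ f ∈ fatIdeal p ![6 * m, 6 * m, 6 * m, 3 * m, 3 * m],
            f ≠ 0 ∧ f.IsHomogeneous (8 * m - 1)) := by
  set F : MvPolynomial (Fin 5 × Fin (3 + 1)) k :=
    ∏ j : Fin 5, (Matrix.of fun i l : Fin 4 =>
      (X (j.succAbove i, l) : MvPolynomial (Fin 5 × Fin (3 + 1)) k)).det with hF
  have hFe : ∀ p : Fin 5 → Fin (3 + 1) → k, eval (fun q => p q.1 q.2) F =
      ∏ j : Fin 5, (Matrix.of fun i : Fin 4 => p (j.succAbove i)).det := by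
    intro p
    rw [hF, map_prod]
    refine Finset.prod_congr rfl fun j _ => ?_
    rw [RingHom.map_det]
    congr 1
    ext i l
    simp
  refine ⟨{F}, ?_, ?_⟩
  · refine ⟨fun j i => (j : ℕ) ^ (i : ℕ), ?_, F, rfl, ?_⟩
    · intro j hj
      have := congrFun hj 0
      simp at this
    · rw [hFe (fun j i => (j : ℕ) ^ (i : ℕ))]
      refine Finset.prod_ne_zero_iff.mpr fun j _ => ?_
      refine (Matrix.det_vandermonde_ne_zero_iff (v := fun i : Fin 4 =>
        (((j.succAbove i : Fin 5) : ℕ) : k))).mpr ?_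
      intro i l hil
      exact Fin.succAbove_right_injective (Fin.ext (Nat.cast_injective hil))
  · rintro p - ⟨f, rfl, hf⟩
    rw [hFe] at hf
    have hp : ∀ j : Fin 5, (Matrix.of fun i : Fin 4 => p (j.succAbove i)).det ≠ 0 :=
      fun j => Finset.prod_ne_zero_iff.mp hf j (Finset.mem_univ j)
    constructor
    · intro γ hγ
      refine ge_of_tendsto hγ ?_
      filter_upwards [eventually_ge_atTop 1] with t ht
      obtain ⟨f, hfI, hf0, hfd⟩ := Nat.sInf_mem
        (exists_form p fun j => t * (![2, 2, 2, 1, 1] : Fin 5 → ℕ) j)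
      have h1 := main_ineq p hp _ _ f hfI hf0 hfd
      have h2 : t * 8 ≤ alpha (fatIdeal (N := 3) p
          fun j => t * (![2, 2, 2, 1, 1] : Fin 5 → ℕ) j) * 3 := by
        refine le_trans (le_of_eq ?_) h1
        rw [← Finset.mul_sum]
        simp [Fin.sum_univ_succ]
      have h3 : (t : ℝ) * 8 ≤ (alpha (fatIdeal (N := 3) p
          fun j => t * (![2, 2, 2, 1, 1] : Fin 5 → ℕ) j) : ℝ) * 3 := by exact_mod_cast h2
      have ht' : (0 : ℝ) < t := by exact_mod_cast ht
      rw [alphaSeq, div_le_div_iff₀ (by norm_num) ht']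
      linarith
    · rintro m hm ⟨f, hfI, hf0, hfd⟩
      have h1 := main_ineq p hp _ _ f hfI hf0 hfd
      simp [Fin.sum_univ_succ] at h1
      omega
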